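/- If D ⊆ ℝⁿ is nonempty, compact, and convex, and F : D → ℝⁿ is continuous, then the solution set SOL(D, F) of the variational inequality VI(D, F) is nonempty and compact. -/

import Mathlib

open scoped RealInnerProductSpace
open Set Metric MeasureTheory

section Projection

variable {E : Type*} [NormedAddCommGroup E] [InnerProductSpace ℝ E]

/-- A nonempty complete convex set admits a nearest-point map, characterised by its variational
inequality. -/
theorem Convex.exists_proj {K : Set E} (hne : K.Nonempty) (hK : IsComplete K)
    (hconv : Convex ℝ K) :
    ∃ P : E → E, (∀ x, P x ∈ K) ∧ ∀ x, ∀ y ∈ K, ⟪x - P x, y - P x⟫ ≤ 0 := by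
  choose P hP hmin using exists_norm_eq_iInf_of_complete_convex hne hK hconv
  exact ⟨P, hP, fun x => (norm_eq_iInf_iff_real_inner_le_zero hconv (hP x)).1 (hmin x)⟩

theorem lipschitzWith_one_of_proj {K : Set E} {P : E → E} (hP : ∀ x, P x ∈ K)
    (hvar : ∀ x, ∀ y ∈ K, ⟪x - P x, y - P x⟫ ≤ 0) : LipschitzWith 1 P := by
  refine LipschitzWith.of_dist_le_mul fun x y => ?_
  rw [dist_eq_norm, dist_eq_norm, NNReal.coe_one, one_mul]
  have h1 := hvar x _ (hP y)
  have h2 := hvar y _ (hP x)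
  have h3 : ⟪P x - P y, P x - P y⟫ ≤ ⟪x - y, P x - P y⟫ := by
    have e : ⟪x - y, P x - P y⟫ - ⟪P x - P y, P x - P y⟫
        = -⟪x - P x, P y - P x⟫ - ⟪y - P y, P x - P y⟫ := by
      simp only [inner_sub_left, inner_sub_right]
      ring
    linarith
  rw [real_inner_self_eq_norm_sq] at h3
  have h4 := real_inner_le_norm (x - y) (P x - P y)
  by_contra! h
  nlinarith [norm_nonneg (x - y), norm_nonneg (P x - P y)]

theorem proj_eq_self {K : Set E} {P : E → E}
    (hvar : ∀ x, ∀ y ∈ K, ⟪x - P x, y - P x⟫ ≤ 0) {x : E} (hx : x ∈ K) : P x = x := by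
  have h := hvar x x hx
  rw [real_inner_self_nonpos, sub_eq_zero] at h
  exact h.symm

theorem norm_proj_closedBall {ρ : ℝ} {P : E → E} (hP : ∀ x, P x ∈ closedBall (0 : E) ρ)
    (hvar : ∀ x, ∀ y ∈ closedBall (0 : E) ρ, ⟪x - P x, y - P x⟫ ≤ 0) {x : E} (hx : ρ ≤ ‖x‖) :
    ‖P x‖ = ρ := by
  have hle : ‖P x‖ ≤ ρ := by simpa using hP x
  refine hle.antisymm ?_
  by_contra! hlt
  have hne : 0 < ‖x - P x‖ := by
    rw [norm_pos_iff, sub_ne_zero]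
    rintro h
    rw [← h] at hlt
    linarith
  set s := (ρ - ‖P x‖) / ‖x - P x‖ with hs
  have hs0 : 0 < s := div_pos (by linarith) hne
  have hmem : P x + s • (x - P x) ∈ closedBall (0 : E) ρ := by
    rw [mem_closedBall_zero_iff]
    refine (norm_add_le _ _).trans ?_
    rw [norm_smul, Real.norm_of_nonneg hs0.le, hs, div_mul_cancel₀ _ hne.ne']
    linarith
  have h := hvar x _ hmem
  rw [add_sub_cancel_left, inner_smul_right, real_inner_self_eq_norm_sq] at h
  have : 0 < s * ‖x - P x‖ ^ 2 := by positivity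
  linarith

end Projection

section Perturbation

variable {E : Type*} [NormedAddCommGroup E]

theorem LipschitzWith.injective_id_add {K : NNReal} {g : E → E} (hg : LipschitzWith K g)
    (hK : K < 1) : Function.Injective fun x => x + g x := by
  intro x y hxy
  have h1 : x - y = g y - g x := by
    rw [sub_eq_sub_iff_add_eq_add]
    simpa [add_comm] using hxy
  have h2 := hg.dist_le_mul y x
  rw [dist_eq_norm, dist_eq_norm, ← h1, norm_sub_rev y x] at h2
  have h3 : (K : ℝ) < 1 := by exact_mod_cast hK
  have h4 : ‖x - y‖ = 0 := by
    by_contra h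
    have : 0 < ‖x - y‖ := lt_of_le_of_ne (norm_nonneg _) (Ne.symm h)
    nlinarith
  exact sub_eq_zero.1 (norm_eq_zero.1 h4)

theorem LipschitzWith.surjective_id_add [CompleteSpace E] {K : NNReal} {g : E → E}
    (hg : LipschitzWith K g) (hK : K < 1) : Function.Surjective fun x => x + g x := by
  intro y
  have hc : ContractingWith K fun x => y - g x := by
    refine ⟨hK, LipschitzWith.of_dist_le_mul fun a b => ?_⟩
    rw [dist_sub_left]
    exact hg.dist_le_mul a b
  have h := hc.fixedPoint_isFixedPt
  exact ⟨_, (sub_eq_iff_eq_add.1 h).symm⟩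

theorem LipschitzWith.image_ball_id_add [CompleteSpace E] {K : NNReal} {g : E → E}
    (hg : LipschitzWith K g) (hK : K < 1) {ρ : ℝ} (h0 : ∀ x, ρ ≤ ‖x‖ → g x = 0) :
    (fun x => x + g x) '' ball 0 ρ = ball 0 ρ := by
  ext y
  constructor
  · rintro ⟨x, hx, rfl⟩
    by_contra hy
    have hy' : ρ ≤ ‖x + g x‖ := by simpa using hy
    have : x + g x = x := by
      apply hg.injective_id_add hK
      simp [h0 _ hy']
    rw [this] at hy'
    exact hy'.not_gt (mem_ball_zero_iff.1 hx)
  · intro hy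
    obtain ⟨x, rfl⟩ := hg.surjective_id_add hK y
    refine ⟨x, ?_, rfl⟩
    by_contra hx
    have hx' : ρ ≤ ‖x‖ := by simpa using hx
    simp only [h0 _ hx', add_zero] at hy
    exact hx hy

end Perturbation

section Determinant

variable {E : Type*} [NormedAddCommGroup E] [NormedSpace ℝ E] [FiniteDimensional ℝ E]

/-- The polynomial `t ↦ det (1 + t A)` interpolated at nodes `v i`, evaluated at `1`. -/
theorem ContinuousLinearMap.det_one_add_eq_sum {v : ℕ → ℝ} (hv : Function.Injective v)
    (A : E →L[ℝ] E) :
    (1 + A).det = ∑ i ∈ Finset.range (Module.finrank ℝ E + 1),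
      (Lagrange.basis (Finset.range (Module.finrank ℝ E + 1)) v i).eval 1 *
        (1 + v i • A).det := by
  let b := Module.finBasis ℝ E
  let M := LinearMap.toMatrix b b (A : E →ₗ[ℝ] E)
  let q : Polynomial ℝ := Matrix.det
    ((Polynomial.X : Polynomial ℝ) • M.map Polynomial.C + (1 : Matrix _ _ ℝ).map Polynomial.C)
  have hq : ∀ t : ℝ, q.eval t = (1 + t • A).det := by
    intro t
    have e : (1 + t • A).det = (t • M + 1).det := by
      rw [ContinuousLinearMap.det, ← LinearMap.det_toMatrix b]
      congr 1
      simp [M, add_comm, ContinuousLinearMap.one_def,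
        ContinuousLinearMap.coe_id]
    rw [e]
    simp only [q]
    rw [← Polynomial.coe_evalRingHom, RingHom.map_det]
    congr 1
    ext i j
    rcases eq_or_ne i j with rfl | h
    · simp [mul_comm t]
    · simp [h, mul_comm t]
  have hdeg : q.degree < (Finset.range (Module.finrank ℝ E + 1)).card := by
    rw [Finset.card_range]
    refine Polynomial.degree_le_natDegree.trans_lt ?_
    have := Polynomial.natDegree_det_X_add_C_le M 1
    rw [Fintype.card_fin] at this
    exact_mod_cast Nat.lt_succ_of_le this
  have h1 : (1 + A).det = q.eval 1 := by rw [hq, one_smul]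
  rw [h1, Lagrange.eq_interpolate (hv.injOn) hdeg, Lagrange.interpolate_apply,
    Polynomial.eval_finsetSum]
  refine Finset.sum_congr rfl fun i _ => ?_
  rw [Polynomial.eval_mul, Polynomial.eval_C, hq, mul_comm]

end Determinant

section Brouwer

variable {E : Type*} [NormedAddCommGroup E] [InnerProductSpace ℝ E] [FiniteDimensional ℝ E]

theorem det_fderiv_eq_zero_of_norm_eventually_const {ρ : ℝ} (hρ : 0 < ρ) {r : E → E} {x : E}
    (hr : DifferentiableAt ℝ r x) (hn : ∀ᶠ y in nhds x, ‖r y‖ = ρ) :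
    (fderiv ℝ r x).det = 0 := by
  have hd := (hr.hasFDerivAt.norm_sq)
  have hc : HasFDerivAt (fun y => ‖r y‖ ^ 2) (0 : E →L[ℝ] ℝ) x :=
    (hasFDerivAt_const (ρ ^ 2) x).congr_of_eventuallyEq (hn.mono fun y hy => by simp [hy])
  have he := hd.unique hc
  by_contra hdet
  have hdet' : IsUnit (LinearMap.det (fderiv ℝ r x : E →ₗ[ℝ] E)) := isUnit_iff_ne_zero.2 hdet
  obtain ⟨w, hw⟩ := (LinearMap.equivOfIsUnitDet hdet').surjective (r x)
  have hw' : fderiv ℝ r x w = r x := by simpa using hw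
  have h1 := DFunLike.congr_fun he w
  simp [hw', hn.self_of_nhds] at h1
  exact hρ.ne' h1

variable [MeasurableSpace E] [BorelSpace E]

theorem integral_det_one_add_fderiv {ρ : ℝ} (hρ : 0 < ρ) {g : E → E}
    (hg : ∀ x ∈ closedBall (0 : E) ρ, ContDiffAt ℝ 1 g x) (h0 : ∀ x, ‖x‖ = ρ → g x = 0) :
    ∫ x in ball (0 : E) ρ, (1 + fderiv ℝ g x).det = volume.real (ball (0 : E) ρ) := by
  have hcont : ContinuousOn (fderiv ℝ g) (closedBall 0 ρ) := fun x hx =>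
    ((hg x hx).fderiv_right (m := 0) (by simp)).continuousAt.continuousWithinAt
  obtain ⟨M, hM⟩ := (isCompact_closedBall (0 : E) ρ).exists_bound_of_continuousOn hcont
  obtain ⟨P, hP, hvar⟩ := Convex.exists_proj (nonempty_closedBall.2 hρ.le)
    (isClosed_closedBall.isComplete) (convex_closedBall (0 : E) ρ)
  have hLip : LipschitzOnWith M.toNNReal g (closedBall 0 ρ) := by
    refine (convex_closedBall (0 : E) ρ).lipschitzOnWith_of_nnnorm_fderiv_le (𝕜 := ℝ)
      (fun x hx => (hg x hx).differentiableAt (by simp)) fun x hx => ?_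
    rw [← NNReal.coe_le_coe, coe_nnnorm]
    exact (hM x hx).trans (Real.le_coe_toNNReal M)
  have hGLip : LipschitzWith M.toNNReal (g ∘ P) := by
    have := hLip.comp (lipschitzWith_one_of_proj hP hvar).lipschitzOnWith
      (s := univ) (fun x _ => hP x)
    rwa [mul_one, lipschitzOnWith_univ] at this
  have hdetpos : ∀ᶠ L : E →L[ℝ] E in nhds 1, 0 < L.det :=
    ContinuousLinearMap.continuous_det.continuousAt.eventually_const_lt (by
      simp [ContinuousLinearMap.det, ContinuousLinearMap.one_def])
  obtain ⟨ε, hε, hball⟩ := Metric.eventually_nhds_iff.1 hdetpos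
  set m : ℝ := ((M.toNNReal : NNReal) : ℝ)
  have hm0 : 0 ≤ m := NNReal.coe_nonneg _
  set δ : ℝ := min 1 ε / (m + 1) with hδ
  have hδ0 : 0 < δ := by positivity
  have hδm : δ * m < min 1 ε := by
    rw [hδ, div_mul_eq_mul_div, div_lt_iff₀ (by positivity)]
    have : 0 < min 1 ε := by positivity
    nlinarith
  have hint : ∀ t : ℝ, IntegrableOn (fun x => (1 + t • fderiv ℝ g x).det) (ball 0 ρ) := by
    intro t
    refine IntegrableOn.mono_set (ContinuousOn.integrableOn_compact
      (isCompact_closedBall (0 : E) ρ) ?_) ball_subset_closedBall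
    exact ContinuousLinearMap.continuous_det.comp_continuousOn
      (continuousOn_const.add (hcont.const_smul t))
  have hsmall : ∀ t : ℝ, 0 < t → t ≤ δ →
      ∫ x in ball (0 : E) ρ, (1 + t • fderiv ℝ g x).det = volume.real (ball (0 : E) ρ) := by
    intro t ht htδ
    have htm : t * m < min 1 ε := (mul_le_mul_of_nonneg_right htδ hm0).trans_lt hδm
    have hL : LipschitzWith (t.toNNReal * M.toNNReal) fun x => t • g (P x) := by
      refine LipschitzWith.of_dist_le_mul fun x y => ?_
      rw [dist_smul₀, NNReal.coe_mul, Real.coe_toNNReal t ht.le, mul_assoc,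
        Real.norm_of_nonneg ht.le]
      exact mul_le_mul_of_nonneg_left (hGLip.dist_le_mul x y) ht.le
    have hK : t.toNNReal * M.toNNReal < 1 := by
      rw [← NNReal.coe_lt_coe, NNReal.coe_mul, Real.coe_toNNReal t ht.le]
      exact htm.trans_le (min_le_left _ _)
    have himg := hL.image_ball_id_add hK (ρ := ρ) fun x hx => by
      rw [h0 _ (norm_proj_closedBall hP hvar hx), smul_zero]
    have hder : ∀ x ∈ ball (0 : E) ρ, HasFDerivWithinAt (fun x => x + t • g (P x))
        (1 + t • fderiv ℝ g x) (ball 0 ρ) x := by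
      intro x hx
      have h1 : HasFDerivAt (fun x => x + t • g x) (1 + t • fderiv ℝ g x) x :=
        (hasFDerivAt_id x).add
          (((hg x (ball_subset_closedBall hx)).differentiableAt
            (by simp)).hasFDerivAt.const_smul t)
      refine h1.hasFDerivWithinAt.congr (fun y hy => ?_) ?_
      · rw [proj_eq_self hvar (ball_subset_closedBall hy)]
      · rw [proj_eq_self hvar (ball_subset_closedBall hx)]
    have hcv := integral_image_eq_integral_abs_det_fderiv_smul volume measurableSet_ball hder
      (hL.injective_id_add hK).injOn (fun _ => (1 : ℝ))
    rw [himg] at hcv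
    have hvol : ∫ _ in ball (0 : E) ρ, (1 : ℝ) = volume.real (ball (0 : E) ρ) := by simp
    rw [← hvol, hcv]
    refine setIntegral_congr_fun measurableSet_ball fun x hx => ?_
    have hpos : 0 < (1 + t • fderiv ℝ g x).det := by
      apply hball
      rw [dist_eq_norm, add_sub_cancel_left, norm_smul, Real.norm_of_nonneg ht.le]
      calc t * ‖fderiv ℝ g x‖ ≤ t * m :=
            mul_le_mul_of_nonneg_left
              ((hM x (ball_subset_closedBall hx)).trans (Real.le_coe_toNNReal M)) ht.le
        _ < ε := htm.trans_le (min_le_right _ _)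
    simp only [abs_of_pos hpos, smul_eq_mul, mul_one]
  let v : ℕ → ℝ := fun i => δ / (i + 1)
  have hv : Function.Injective v := by
    intro i j hij
    have hij' : δ / ((i : ℝ) + 1) = δ / ((j : ℝ) + 1) := hij
    rw [div_eq_div_iff (by positivity) (by positivity)] at hij'
    have := mul_left_cancel₀ hδ0.ne' hij'
    exact_mod_cast (add_right_cancel this).symm
  have hvs : ∀ i, ∫ x in ball (0 : E) ρ, (1 + v i • fderiv ℝ g x).det
      = volume.real (ball (0 : E) ρ) := fun i =>
    hsmall _ (by positivity) (div_le_self hδ0.le (by simp))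
  rw [integral_congr_ae (.of_forall fun x =>
      ContinuousLinearMap.det_one_add_eq_sum hv (fderiv ℝ g x)),
    integral_finsetSum _ fun i _ => (hint (v i)).const_mul _]
  simp_rw [integral_const_mul, hvs]
  rw [← Finset.sum_mul, ← Polynomial.eval_finsetSum,
    Lagrange.sum_basis hv.injOn (Finset.nonempty_range_iff.2 (Nat.succ_ne_zero _)),
    Polynomial.eval_one, one_mul]

theorem no_contDiff_retraction {ρ : ℝ} (hρ : 0 < ρ) {r : E → E}
    (hr : ∀ x ∈ closedBall (0 : E) ρ, ContDiffAt ℝ 1 r x)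
    (hn : ∀ x ∈ closedBall (0 : E) ρ, ‖r x‖ = ρ) (hid : ∀ x, ‖x‖ = ρ → r x = x) : False := by
  have h := integral_det_one_add_fderiv hρ (g := fun x => r x - x)
    (fun x hx => (hr x hx).sub contDiffAt_id) fun x hx => by rw [hid x hx, sub_self]
  have hz : ∫ x in ball (0 : E) ρ, (1 + fderiv ℝ (fun x => r x - x) x).det = 0 := by
    refine setIntegral_eq_zero_of_forall_eq_zero fun x hx => ?_
    have hd := (hr x (ball_subset_closedBall hx)).differentiableAt (by simp)
    have e : fderiv ℝ (fun x => r x - x) x = fderiv ℝ r x - 1 :=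
      (hd.hasFDerivAt.sub (hasFDerivAt_id x)).fderiv
    rw [e, add_sub_cancel]
    refine det_fderiv_eq_zero_of_norm_eventually_const hρ hd ?_
    filter_upwards [isOpen_ball.mem_nhds hx] with y hy using hn y (ball_subset_closedBall hy)
  rw [hz] at h
  have hpos : 0 < volume.real (ball (0 : E) ρ) :=
    ENNReal.toReal_pos (measure_ball_pos volume 0 hρ).ne' measure_ball_lt_top.ne
  exact hpos.ne h

theorem ContDiff.exists_fixedPoint {ρ : ℝ} {p : E → E} (hp : ContDiff ℝ 1 p)
    (hb : ∀ x, ‖p x‖ < ρ) : ∃ x, p x = x := by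
  by_contra! hfix
  have hρ : 0 < ρ := (norm_nonneg _).trans_lt (hb 0)
  let u : E → E := fun x => x - p x
  have hu : ∀ x, 0 < ‖u x‖ := fun x => norm_pos_iff.2 (sub_ne_zero.2 (hfix x).symm)
  have huC : ContDiff ℝ 1 u := contDiff_id.sub hp
  let disc : E → ℝ := fun x => ⟪x, u x⟫ ^ 2 + ‖u x‖ ^ 2 * (ρ ^ 2 - ‖x‖ ^ 2)
  have hdC : ContDiff ℝ 1 disc :=
    ((contDiff_id.inner ℝ huC).pow 2).add
      ((huC.norm_sq ℝ).mul (contDiff_const.sub (contDiff_id.norm_sq ℝ)))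
  have hsphere : ∀ x, ‖x‖ = ρ → 0 < ⟪x, u x⟫ := by
    intro x hx
    have h1 := real_inner_le_norm x (p x)
    have h2 : ⟪x, u x⟫ = ρ ^ 2 - ⟪x, p x⟫ := by
      rw [inner_sub_right, real_inner_self_eq_norm_sq, hx]
    rw [hx] at h1
    nlinarith [hb x]
  have hdisc : ∀ x ∈ closedBall (0 : E) ρ, 0 < disc x := by
    intro x hx
    rw [mem_closedBall_zero_iff] at hx
    rcases hx.eq_or_lt with h | h
    · have := hsphere x h
      simp only [disc, h, sub_self, mul_zero, add_zero]
      positivity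
    · have h1 : 0 < ρ ^ 2 - ‖x‖ ^ 2 := by nlinarith [norm_nonneg x]
      have h2 := hu x
      positivity
  let l : E → ℝ := fun x => (-⟪x, u x⟫ + √(disc x)) / ‖u x‖ ^ 2
  refine no_contDiff_retraction hρ (r := fun x => x + l x • u x) (fun x hx => ?_)
    (fun x hx => ?_) fun x hx => ?_
  · have hl : ContDiffAt ℝ 1 l x :=
      ((contDiff_id.inner ℝ huC).contDiffAt.neg.add
        (hdC.contDiffAt.sqrt (hdisc x hx).ne')).div (huC.norm_sq ℝ).contDiffAt
        (pow_pos (hu x) 2).ne'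
    exact contDiffAt_id.add (hl.smul huC.contDiffAt)
  · have hs := Real.sq_sqrt (hdisc x hx).le
    have hl : l x * ‖u x‖ ^ 2 = -⟪x, u x⟫ + √(disc x) :=
      div_mul_cancel₀ _ (pow_pos (hu x) 2).ne'
    have hd : disc x = ⟪x, u x⟫ ^ 2 + ‖u x‖ ^ 2 * (ρ ^ 2 - ‖x‖ ^ 2) := rfl
    have hsq : ‖x + l x • u x‖ ^ 2 = ρ ^ 2 := by
      rw [norm_add_sq_real, inner_smul_right, norm_smul, mul_pow, Real.norm_eq_abs, sq_abs]
      have h2 : ‖u x‖ ^ 2 * (‖x‖ ^ 2 + 2 * (l x * ⟪x, u x⟫) + l x ^ 2 * ‖u x‖ ^ 2)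
          = ‖u x‖ ^ 2 * ρ ^ 2 := by
        have h3 : (l x * ‖u x‖ ^ 2 + ⟪x, u x⟫) ^ 2 = disc x := by
          rw [hl, neg_add_cancel_comm, hs]
        linear_combination h3 + hd
      exact mul_left_cancel₀ (pow_pos (hu x) 2).ne' h2
    exact (pow_left_inj₀ (norm_nonneg _) hρ.le two_ne_zero).1 hsq
  · have hl : l x = 0 := by
      simp only [l, disc, hx, sub_self, mul_zero, add_zero, Real.sqrt_sq (hsphere x hx).le,
        neg_add_cancel, zero_div]
    simp only [hl, zero_smul, add_zero]

/-- Brouwer's fixed point theorem for bounded uniformly continuous self-maps of the space. -/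
theorem UniformContinuous.exists_fixedPoint {R : ℝ} {f : E → E} (hf : UniformContinuous f)
    (hb : ∀ x, ‖f x‖ ≤ R) : ∃ x, f x = x := by
  have hR : 0 ≤ R := (norm_nonneg _).trans (hb 0)
  obtain ⟨x, -, hx⟩ := (isCompact_closedBall (0 : E) (R + 1)).exists_isMinOn
    (nonempty_closedBall.2 (by linarith))
    (f := fun x => dist (f x) x) (hf.continuous.dist continuous_id).continuousOn
  refine ⟨x, ?_⟩
  by_contra hne
  have hpos : 0 < dist (f x) x := dist_pos.2 hne
  obtain ⟨p, hp, hpf⟩ := hf.exists_contDiff_dist_le (lt_min hpos one_pos)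
  have hpb : ∀ y, ‖p y‖ < R + 1 := by
    intro y
    have h1 : ‖p y - f y‖ < 1 := by
      rw [← dist_eq_norm]
      exact (hpf y).trans_le (min_le_right _ _)
    have h2 := norm_le_norm_add_norm_sub' (p y) (f y)
    linarith [hb y]
  obtain ⟨y, hy⟩ := (hp.of_le (by norm_cast)).exists_fixedPoint hpb
  have hyb : y ∈ closedBall (0 : E) (R + 1) := by
    rw [mem_closedBall_zero_iff, ← hy]
    exact (hpb y).le
  have h1 : dist (f x) x ≤ dist (f y) y := hx hyb
  have h2 := (hpf y).trans_le (min_le_left _ _)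
  rw [hy, dist_comm] at h2
  linarith

end Brouwer

/-- For nonempty compact convex D and continuous F, the solution set of VI(D,F)
is nonempty and compact. -/
theorem vi_sol_nonempty_compact {n : ℕ} (D : Set (EuclideanSpace ℝ (Fin n)))
    (hne : D.Nonempty) (hcomp : IsCompact D) (hconv : Convex ℝ D)
    (F : EuclideanSpace ℝ (Fin n) → EuclideanSpace ℝ (Fin n)) (hF : ContinuousOn F D) :
    ({x ∈ D | ∀ y ∈ D, 0 ≤ ⟪y - x, F x⟫}).Nonempty ∧
      IsCompact {x ∈ D | ∀ y ∈ D, 0 ≤ ⟪y - x, F x⟫} := by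
  constructor
  · obtain ⟨P, hP, hvar⟩ := Convex.exists_proj hne hcomp.isComplete hconv
    have hPu := (lipschitzWith_one_of_proj hP hvar).uniformContinuous
    have hFP : UniformContinuous fun x => F (P x) := by
      rw [← uniformContinuousOn_univ]
      exact (hcomp.uniformContinuousOn_of_continuous hF).comp hPu.uniformContinuousOn
        fun x _ => hP x
    obtain ⟨R, hR⟩ := hcomp.isBounded.exists_norm_le
    obtain ⟨x, hx⟩ := (hPu.comp (hPu.sub hFP)).exists_fixedPoint fun x => hR _ (hP _)
    have hx' : P (P x - F (P x)) = x := hx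
    have hxD : x ∈ D := hx' ▸ hP _
    rw [proj_eq_self hvar hxD] at hx'
    refine ⟨x, hxD, fun y hy => ?_⟩
    have h := hvar (x - F x) y hy
    rw [hx', sub_sub_cancel_left, inner_neg_left, real_inner_comm] at h
    linarith
  · refine hcomp.of_isClosed_subset ?_ (sep_subset _ _)
    have e : {x ∈ D | ∀ y ∈ D, 0 ≤ ⟪y - x, F x⟫}
        = D ∩ ⋂ y ∈ D, {x ∈ D | 0 ≤ ⟪y - x, F x⟫} := by
      ext x
      simp +contextual
    rw [e]
    refine hcomp.isClosed.inter (isClosed_biInter fun y _ => ?_)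
    exact hcomp.isClosed.isClosed_le continuousOn_const
      ((continuousOn_const.sub continuousOn_id).inner hF)
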